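/- Let (A^{p,q}, d', d'') be a totally bounded double complex of complex vector spaces. Suppose that for every (p,q) ∈ ℤ² the spaces H_{BC}^{p,q}, H_{d'}^{p,q} and H_{d''}^{p,q} are finite dimensional and dim_ℂ H_{BC}^{p,q} = dim_ℂ H_{d'}^{p,q} = dim_ℂ H_{d''}^{p,q}. Then the double complex satisfies the d'd''-lemma, i.e., for every (p,q): Im d' ∩ ker d'' ∩ A^{p,q} = ker d' ∩ Im d'' ∩ A^{p,q} = Im d'd'' ∩ A^{p,q}. -/

import Mathlib

open Submodule

/-- A double complex of complex vector spaces, realized as an internally bigraded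
module `W = ⊕_{p,q} A p q` together with global differentials `d'`, `d''` of
bidegrees `(1,0)` and `(0,1)` satisfying `d'∘d' = 0`, `d''∘d'' = 0` and
`d'∘d'' + d''∘d' = 0`. -/
structure BiComplex (W : Type*) [AddCommGroup W] [Module ℂ W] where
  A : ℤ → ℤ → Submodule ℂ W
  d' : W →ₗ[ℂ] W
  d'' : W →ₗ[ℂ] W
  internal : DirectSum.IsInternal (fun pq : ℤ × ℤ => A pq.1 pq.2)
  map_d' : ∀ p q : ℤ, (A p q).map d' ≤ A (p + 1) q
  map_d'' : ∀ p q : ℤ, (A p q).map d'' ≤ A p (q + 1)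
  d'_sq : d' ∘ₗ d' = 0
  d''_sq : d'' ∘ₗ d'' = 0
  anticomm : d' ∘ₗ d'' + d'' ∘ₗ d' = 0

namespace BiComplex

variable {W : Type*} [AddCommGroup W] [Module ℂ W] (C : BiComplex W)

/-- `ker d' ∩ A^{p,q}` : the kernel of `d' : A^{p,q} → A^{p+1,q}`. -/
def kerd' (p q : ℤ) : Submodule ℂ W := LinearMap.ker C.d' ⊓ C.A p q

/-- `ker d'' ∩ A^{p,q}` : the kernel of `d'' : A^{p,q} → A^{p,q+1}`. -/
def kerd'' (p q : ℤ) : Submodule ℂ W := LinearMap.ker C.d'' ⊓ C.A p q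

/-- `Im d' ∩ A^{p,q} = d'(A^{p-1,q})`. -/
def imd' (p q : ℤ) : Submodule ℂ W := (C.A (p - 1) q).map C.d'

/-- `Im d'' ∩ A^{p,q} = d''(A^{p,q-1})`. -/
def imd'' (p q : ℤ) : Submodule ℂ W := (C.A p (q - 1)).map C.d''

/-- `Im d'd'' ∩ A^{p,q} = (d'∘d'')(A^{p-1,q-1})`. -/
def imd'd'' (p q : ℤ) : Submodule ℂ W := (C.A (p - 1) (q - 1)).map (C.d' ∘ₗ C.d'')

/-- `ker d'd'' ∩ A^{p,q}` : the kernel of `d'∘d'' : A^{p,q} → A^{p+1,q+1}`. -/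
def kerd'd'' (p q : ℤ) : Submodule ℂ W := LinearMap.ker (C.d' ∘ₗ C.d'') ⊓ C.A p q

/-- The `d'd''`-lemma at `(p,q)`:
`Im d' ∩ ker d'' ∩ A^{p,q} = ker d' ∩ Im d'' ∩ A^{p,q} = Im d'd'' ∩ A^{p,q}`. -/
def DDLemmaAt (p q : ℤ) : Prop :=
  C.imd' p q ⊓ C.kerd'' p q = C.imd'd'' p q ∧ C.kerd' p q ⊓ C.imd'' p q = C.imd'd'' p q

/-- The total-degree piece `A^k = ⊕_{p+q=k} A^{p,q}`. -/
def Atot (k : ℤ) : Submodule ℂ W := ⨆ p : ℤ, C.A p (k - p)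

/-- The total differential `d = d' + d''`. -/
def dtot : W →ₗ[ℂ] W := C.d' + C.d''

/-- `ker d ∩ A^k` : the kernel of `d : A^k → A^{k+1}`. -/
def kerdTot (k : ℤ) : Submodule ℂ W := LinearMap.ker C.dtot ⊓ C.Atot k

/-- `Im d ∩ A^k = d(A^{k-1})`. -/
def imdTot (k : ℤ) : Submodule ℂ W := (C.Atot (k - 1)).map C.dtot

/-- `ker d' ∩ ker d'' ∩ A^k = ⊕_{p+q=k} (ker d' ∩ ker d'' ∩ A^{p,q})`. -/
def kerd'kerd''Tot (k : ℤ) : Submodule ℂ W :=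
  ⨆ p : ℤ, (C.kerd' p (k - p) ⊓ C.kerd'' p (k - p))

/-- `Im d'd'' ∩ A^k = ⊕_{p+q=k} (Im d'd'' ∩ A^{p,q})`. -/
def imd'd''Tot (k : ℤ) : Submodule ℂ W := ⨆ p : ℤ, C.imd'd'' p (k - p)

/-- `ker d'd'' ∩ A^k = ⊕_{p+q=k} (ker d'd'' ∩ A^{p,q})`. -/
def kerd'd''Tot (k : ℤ) : Submodule ℂ W := ⨆ p : ℤ, C.kerd'd'' p (k - p)

/-- `Im d' ∩ A^k = ⊕_{p+q=k} (Im d' ∩ A^{p,q})`. -/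
def imd'Tot (k : ℤ) : Submodule ℂ W := ⨆ p : ℤ, C.imd' p (k - p)

/-- `Im d'' ∩ A^k = ⊕_{p+q=k} (Im d'' ∩ A^{p,q})`. -/
def imd''Tot (k : ℤ) : Submodule ℂ W := ⨆ p : ℤ, C.imd'' p (k - p)

/-- The double complex is totally bounded: `A^{p,q} = 0` for `|p| > N` or `|q| > N`. -/
def TotallyBounded : Prop :=
  ∃ N : ℕ, ∀ p q : ℤ, ((N : ℤ) < |p| ∨ (N : ℤ) < |q|) → C.A p q = ⊥

end BiComplex

/-- The quotient vector space `S / T` of a submodule `S` by (the trace of) a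
submodule `T ≤ S`. -/
abbrev quotSub {W : Type*} [AddCommGroup W] [Module ℂ W] (S T : Submodule ℂ W) :=
  S ⧸ (Submodule.comap S.subtype T)

/-- If the natural map `S₁ / T₁ → S₂ / T₂` is surjective between finite-dimensional spaces of the
same dimension, then it is injective. -/
theorem quotSub_inf_le_of_finrank_eq {W : Type*} [AddCommGroup W] [Module ℂ W]
    {S₁ S₂ T₁ T₂ : Submodule ℂ W} (hS : S₁ ≤ S₂) (hT : T₁ ≤ T₂)
    [FiniteDimensional ℂ (quotSub S₁ T₁)] [FiniteDimensional ℂ (quotSub S₂ T₂)]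
    (hrank : Module.finrank ℂ (quotSub S₁ T₁) = Module.finrank ℂ (quotSub S₂ T₂))
    (hsurj : ∀ x ∈ S₂, ∃ y ∈ S₁, x - y ∈ T₂) : S₁ ⊓ T₂ ≤ T₁ := by
  let f : quotSub S₁ T₁ →ₗ[ℂ] quotSub S₂ T₂ :=
    Submodule.mapQ _ _ (Submodule.inclusion hS) (fun x hx => hT hx)
  have hf : Function.Surjective f := by
    intro z
    obtain ⟨⟨x, hx⟩, rfl⟩ := Submodule.Quotient.mk_surjective _ z
    obtain ⟨y, hy, hxy⟩ := hsurj x hx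
    refine ⟨Submodule.Quotient.mk ⟨y, hy⟩, Eq.symm ?_⟩
    exact (Submodule.Quotient.eq _).2 hxy
  have hinj : Function.Injective f :=
    (LinearMap.injective_iff_surjective_of_finrank_eq_finrank hrank).2 hf
  rintro x ⟨hx₁, hx₂⟩
  have hzero : f (Submodule.Quotient.mk ⟨x, hx₁⟩) = 0 :=
    (Submodule.Quotient.mk_eq_zero _).2 hx₂
  have hmem := (Submodule.Quotient.mk_eq_zero _).1 (hinj (hzero.trans (map_zero f).symm))
  exact hmem

namespace BiComplex

variable {W : Type*} [AddCommGroup W] [Module ℂ W] (C : BiComplex W)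

theorem d'_d'_apply (x : W) : C.d' (C.d' x) = 0 := LinearMap.congr_fun C.d'_sq x

theorem d''_d''_apply (x : W) : C.d'' (C.d'' x) = 0 := LinearMap.congr_fun C.d''_sq x

theorem d'_d''_apply (x : W) : C.d' (C.d'' x) = -C.d'' (C.d' x) :=
  eq_neg_of_add_eq_zero_left (LinearMap.congr_fun C.anticomm x)

theorem d'_mem {p q : ℤ} {x : W} (hx : x ∈ C.A (p - 1) q) : C.d' x ∈ C.A p q := by
  simpa using C.map_d' (p - 1) q (Submodule.mem_map_of_mem hx)

theorem d''_mem {p q : ℤ} {x : W} (hx : x ∈ C.A p (q - 1)) : C.d'' x ∈ C.A p q := by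
  simpa using C.map_d'' p (q - 1) (Submodule.mem_map_of_mem hx)

theorem imd'd''_le_imd' (p q : ℤ) : C.imd'd'' p q ≤ C.imd' p q := by
  rintro _ ⟨a, ha, rfl⟩
  exact ⟨C.d'' a, C.d''_mem ha, rfl⟩

theorem imd'd''_le_imd'' (p q : ℤ) : C.imd'd'' p q ≤ C.imd'' p q := by
  rintro _ ⟨a, ha, rfl⟩
  exact ⟨-C.d' a, neg_mem (C.d'_mem ha), by simp [d'_d''_apply]⟩

theorem imd'_le_kerd' (p q : ℤ) : C.imd' p q ≤ C.kerd' p q := by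
  rintro _ ⟨a, ha, rfl⟩
  exact ⟨C.d'_d'_apply a, C.d'_mem ha⟩

theorem imd''_le_kerd'' (p q : ℤ) : C.imd'' p q ≤ C.kerd'' p q := by
  rintro _ ⟨a, ha, rfl⟩
  exact ⟨C.d''_d''_apply a, C.d''_mem ha⟩

/-- If `Im d' ∩ ker d'' = Im d'd''` in bidegree `(p+1,q)`, then `H_BC → H_{d''}` is surjective in
bidegree `(p,q)`, and equality of dimensions makes it injective. -/
theorem kerd'_inf_imd''_le_of_finrank_eq {p q : ℤ}
    [FiniteDimensional ℂ (quotSub (C.kerd' p q ⊓ C.kerd'' p q) (C.imd'd'' p q))]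
    [FiniteDimensional ℂ (quotSub (C.kerd'' p q) (C.imd'' p q))]
    (hrank : Module.finrank ℂ (quotSub (C.kerd' p q ⊓ C.kerd'' p q) (C.imd'd'' p q)) =
      Module.finrank ℂ (quotSub (C.kerd'' p q) (C.imd'' p q)))
    (h : C.imd' (p + 1) q ⊓ C.kerd'' (p + 1) q ≤ C.imd'd'' (p + 1) q) :
    C.kerd' p q ⊓ C.imd'' p q ≤ C.imd'd'' p q := by
  refine fun x hx => quotSub_inf_le_of_finrank_eq inf_le_right (C.imd'd''_le_imd'' p q) hrank ?_
    ⟨⟨hx.1, C.imd''_le_kerd'' p q hx.2⟩, hx.2⟩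
  rintro x ⟨hx, hxA⟩
  have hx0 : C.d'' x = 0 := hx
  have hxA' : x ∈ C.A (p + 1 - 1) q := by simpa using hxA
  obtain ⟨a, ha, hax⟩ := h ⟨⟨x, hxA', rfl⟩, by
    simpa [hx0] using (C.d'_d''_apply x).symm, C.d'_mem hxA'⟩
  replace ha : a ∈ C.A p (q - 1) := by simpa using ha
  replace hax : C.d' (C.d'' a) = C.d' x := hax
  have hy : x - C.d'' a ∈ C.A p q := sub_mem hxA (C.d''_mem ha)
  refine ⟨x - C.d'' a, ⟨⟨?_, hy⟩, ?_, hy⟩, a, ha, by simp⟩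
  · simp [hax]
  · simp [hx0, d''_d''_apply]

/-- If `ker d' ∩ Im d'' = Im d'd''` in bidegree `(p,q+1)`, then `H_BC → H_{d'}` is surjective in
bidegree `(p,q)`, and equality of dimensions makes it injective. -/
theorem imd'_inf_kerd''_le_of_finrank_eq {p q : ℤ}
    [FiniteDimensional ℂ (quotSub (C.kerd' p q ⊓ C.kerd'' p q) (C.imd'd'' p q))]
    [FiniteDimensional ℂ (quotSub (C.kerd' p q) (C.imd' p q))]
    (hrank : Module.finrank ℂ (quotSub (C.kerd' p q ⊓ C.kerd'' p q) (C.imd'd'' p q)) =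
      Module.finrank ℂ (quotSub (C.kerd' p q) (C.imd' p q)))
    (h : C.kerd' p (q + 1) ⊓ C.imd'' p (q + 1) ≤ C.imd'd'' p (q + 1)) :
    C.imd' p q ⊓ C.kerd'' p q ≤ C.imd'd'' p q := by
  refine fun x hx => quotSub_inf_le_of_finrank_eq inf_le_left (C.imd'd''_le_imd' p q) hrank ?_
    ⟨⟨C.imd'_le_kerd' p q hx.1, hx.2⟩, hx.1⟩
  rintro x ⟨hx, hxA⟩
  have hx0 : C.d' x = 0 := hx
  have hxA' : x ∈ C.A p (q + 1 - 1) := by simpa using hxA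
  obtain ⟨a, ha, hax⟩ := h ⟨⟨by simpa [hx0] using C.d'_d''_apply x, C.d''_mem hxA'⟩,
    ⟨x, hxA', rfl⟩⟩
  replace ha : a ∈ C.A (p - 1) q := by simpa using ha
  replace hax : C.d' (C.d'' a) = C.d'' x := hax
  have hy : x + C.d' a ∈ C.A p q := add_mem hxA (C.d'_mem ha)
  refine ⟨x + C.d' a, ⟨⟨?_, hy⟩, ?_, hy⟩, -a, neg_mem ha, by simp⟩
  · simp [hx0, d'_d'_apply]
  · simp [← hax, d'_d''_apply]

end BiComplex

/-- Let `(A^{p,q}, d', d'')` be a totally bounded double complex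
of complex vector spaces.  If for every `(p,q)` the spaces `H_BC^{p,q}`,
`H_{d'}^{p,q}` and `H_{d''}^{p,q}` are finite dimensional with
`dim H_BC^{p,q} = dim H_{d'}^{p,q} = dim H_{d''}^{p,q}`, then the double complex
satisfies the `d'd''`-lemma. -/
theorem bicomplex_dim_BC_eq_dim_d'_implies_ddlemma
    {W : Type*} [AddCommGroup W] [Module ℂ W] (C : BiComplex W)
    (hbd : C.TotallyBounded)
    (hBCfin : ∀ p q : ℤ, FiniteDimensional ℂ
      (quotSub (C.kerd' p q ⊓ C.kerd'' p q) (C.imd'd'' p q)))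
    (hd'fin : ∀ p q : ℤ, FiniteDimensional ℂ
      (quotSub (C.kerd' p q) (C.imd' p q)))
    (hd''fin : ∀ p q : ℤ, FiniteDimensional ℂ
      (quotSub (C.kerd'' p q) (C.imd'' p q)))
    (heq1 : ∀ p q : ℤ,
      Module.finrank ℂ (quotSub (C.kerd' p q ⊓ C.kerd'' p q) (C.imd'd'' p q)) =
        Module.finrank ℂ (quotSub (C.kerd' p q) (C.imd' p q)))
    (heq2 : ∀ p q : ℤ,
      Module.finrank ℂ (quotSub (C.kerd' p q ⊓ C.kerd'' p q) (C.imd'd'' p q)) =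
        Module.finrank ℂ (quotSub (C.kerd'' p q) (C.imd'' p q))) :
    ∀ p q : ℤ, C.DDLemmaAt p q := by
  obtain ⟨N, hN⟩ := hbd
  have key : ∀ n : ℕ, ∀ p q : ℤ, 2 * (N : ℤ) + 1 - n ≤ p + q →
      C.imd' p q ⊓ C.kerd'' p q ≤ C.imd'd'' p q ∧
        C.kerd' p q ⊓ C.imd'' p q ≤ C.imd'd'' p q := by
    intro n
    induction n with
    | zero =>
      intro p q hpq
      have hA : C.A p q = ⊥ := by
        refine hN p q ?_
        by_contra! hcon
        have hp := (le_abs_self p).trans hcon.1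
        have hq := (le_abs_self q).trans hcon.2
        push_cast at hpq
        linarith
      have hbot : C.A p q ≤ C.imd'd'' p q := hA ▸ bot_le
      exact ⟨fun x hx => hbot hx.2.2, fun x hx => hbot hx.1.2⟩
    | succ n ih =>
      intro p q hpq
      push_cast at hpq
      have := hBCfin p q
      have := hd'fin p q
      have := hd''fin p q
      exact ⟨C.imd'_inf_kerd''_le_of_finrank_eq (heq1 p q) (ih p (q + 1) (by linarith)).2,
        C.kerd'_inf_imd''_le_of_finrank_eq (heq2 p q) (ih (p + 1) q (by linarith)).1⟩
  intro p q
  obtain ⟨h₁, h₂⟩ := key (2 * (N : ℤ) + 1 - (p + q)).toNat p q (by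
    linarith [Int.self_le_toNat (2 * (N : ℤ) + 1 - (p + q))])
  exact ⟨le_antisymm h₁ (le_inf (C.imd'd''_le_imd' p q)
      ((C.imd'd''_le_imd'' p q).trans (C.imd''_le_kerd'' p q))),
    le_antisymm h₂ (le_inf ((C.imd'd''_le_imd' p q).trans (C.imd'_le_kerd' p q))
      (C.imd'd''_le_imd'' p q))⟩
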